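/- Let (X, Y) be a bivariate normal pair with means μ_X, μ_Y, standard deviations σ_X, σ_Y > 0 and correlation ρ ∈ [−1, 1], let c ∈ ℝ with z_c = (c − μ_X)/σ_X, and let W = min(X, c) be the right-censored observation of X at limit c. Then the expected conditional variance of Y given the σ-algebra generated by W satisfies E[Y²] − E[(E[Y | σ(W)])²] = σ_Y² · (1 − ρ² · h(z_c)), where h is the censoring adjustment function. -/

import Mathlib

open MeasureTheory ProbabilityTheory Real

/-- The standard normal density. -/
noncomputable def normPDF (t : ℝ) : ℝ := Real.exp (-t ^ 2 / 2) / Real.sqrt (2 * Real.pi)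

/-- The standard normal cumulative distribution function. -/
noncomputable def normCDF (t : ℝ) : ℝ := ∫ s in Set.Iic t, normPDF s

/-- The censoring adjustment function `h(z) = Φ(z) − z·φ(z) + φ(z)²/(1 − Φ(z))`. -/
noncomputable def censorAdj (z : ℝ) : ℝ :=
  normCDF z - z * normPDF z + (normPDF z) ^ 2 / (1 - normCDF z)

lemma normPDF_eq_gaussianPDFReal : normPDF = gaussianPDFReal 0 1 := by
  ext t
  simp [normPDF, gaussianPDFReal, div_eq_mul_inv, mul_comm]

lemma hasDerivAt_normPDF (t : ℝ) : HasDerivAt normPDF (-(t * normPDF t)) t := by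
  have h : HasDerivAt (fun s : ℝ => -s ^ 2 / 2) (-t) t := by
    refine ((hasDerivAt_pow 2 t).neg.div_const 2).congr_deriv ?_
    norm_num
    ring
  refine (h.exp.div_const (Real.sqrt (2 * Real.pi))).congr_deriv ?_
  simp only [normPDF]
  ring

lemma integrable_normPDF : Integrable normPDF :=
  normPDF_eq_gaussianPDFReal ▸ integrable_gaussianPDFReal 0 1

lemma integrable_pow_mul_normPDF (n : ℕ) : Integrable fun t => t ^ n * normPDF t := by
  have h := (integrable_rpow_mul_exp_neg_mul_sq (b := 1 / 2) (by norm_num)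
    (s := n) (by linarith [n.cast_nonneg (α := ℝ)])).div_const (Real.sqrt (2 * Real.pi))
  refine h.congr (ae_of_all _ fun t => ?_)
  simp only [normPDF, Real.rpow_natCast]
  rw [show -(1 / 2) * t ^ 2 = -t ^ 2 / 2 by ring, mul_div_assoc]

lemma integrable_mul_normPDF : Integrable fun t => t * normPDF t := by
  simpa using integrable_pow_mul_normPDF 1

lemma setIntegral_gaussianReal_eq_normPDF (f : ℝ → ℝ) {s : Set ℝ} (hs : MeasurableSet s) :
    ∫ t in s, f t ∂(gaussianReal 0 1) = ∫ t in s, f t * normPDF t := by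
  rw [gaussianReal_of_var_ne_zero 0 one_ne_zero,
    setIntegral_withDensity_eq_setIntegral_toReal_smul (measurable_gaussianPDF 0 1)
      (ae_of_all _ fun _ => gaussianPDF_lt_top) f hs]
  simp [toReal_gaussianPDF, normPDF_eq_gaussianPDFReal, mul_comm]

lemma normCDF_eq_gaussianReal_Iio (z : ℝ) : normCDF z = (gaussianReal 0 1).real (Set.Iio z) := by
  have h := setIntegral_gaussianReal_eq_normPDF (fun _ => 1) (measurableSet_Iio (a := z))
  rw [setIntegral_const, smul_eq_mul, mul_one] at h
  simp [h, normCDF, integral_Iic_eq_integral_Iio]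

lemma one_sub_normCDF_eq_gaussianReal_Ici (z : ℝ) :
    1 - normCDF z = (gaussianReal 0 1).real (Set.Ici z) := by
  rw [normCDF_eq_gaussianReal_Iio, ← Set.compl_Iio, probReal_compl_eq_one_sub measurableSet_Iio]

lemma one_sub_normCDF_ne_zero (z : ℝ) : 1 - normCDF z ≠ 0 := by
  rw [one_sub_normCDF_eq_gaussianReal_Ici, Measure.real, ENNReal.toReal_ne_zero]
  refine ⟨fun h => ?_, measure_ne_top _ _⟩
  have := gaussianReal_absolutelyContinuous' 0 one_ne_zero h
  simp at this

lemma setIntegral_Ici_id_gaussianReal (z : ℝ) :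
    ∫ t in Set.Ici z, t ∂(gaussianReal 0 1) = normPDF z := by
  have hderiv (t : ℝ) : HasDerivAt (fun s => -normPDF s) (t * normPDF t) t :=
    (hasDerivAt_normPDF t).neg.congr_deriv (neg_neg _)
  rw [setIntegral_gaussianReal_eq_normPDF _ measurableSet_Ici, integral_Ici_eq_integral_Ioi,
    integral_Ioi_of_hasDerivAt_of_tendsto' (fun t _ => hderiv t)
      integrable_mul_normPDF.integrableOn
      (tendsto_zero_of_hasDerivAt_of_integrableOn_Ioi (a := z) (fun t _ => hderiv t)
        integrable_mul_normPDF.integrableOn integrable_normPDF.neg.integrableOn)]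
  ring

lemma setIntegral_Iio_sq_gaussianReal (z : ℝ) :
    ∫ t in Set.Iio z, t ^ 2 ∂(gaussianReal 0 1) = normCDF z - z * normPDF z := by
  have hderiv (t : ℝ) :
      HasDerivAt (fun s => -(s * normPDF s)) (t ^ 2 * normPDF t - normPDF t) t := by
    refine ((hasDerivAt_id t).mul (hasDerivAt_normPDF t)).neg.congr_deriv ?_
    simp only [id]
    ring
  have hint := (integrable_pow_mul_normPDF 2).sub integrable_normPDF
  have h := integral_Iic_of_hasDerivAt_of_tendsto' (a := z) (fun t _ => hderiv t)
    hint.integrableOn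
    (tendsto_zero_of_hasDerivAt_of_integrableOn_Iic (a := z) (fun t _ => hderiv t)
      hint.integrableOn integrable_mul_normPDF.neg.integrableOn)
  rw [integral_sub (integrable_pow_mul_normPDF 2).integrableOn
    integrable_normPDF.integrableOn] at h
  rw [setIntegral_gaussianReal_eq_normPDF _ measurableSet_Iio, ← integral_Iic_eq_integral_Iio,
    normCDF]
  linarith

lemma integral_sq_gaussianReal (μ : ℝ) (v : NNReal) :
    ∫ x, x ^ 2 ∂(gaussianReal μ v) = v + μ ^ 2 := by
  have h := variance_eq_sub (memLp_id_gaussianReal (μ := μ) (v := v) 2)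
  rw [variance_id_gaussianReal] at h
  simp only [Pi.pow_apply, id, integral_id_gaussianReal] at h
  linarith

/-- If `f` is `m`-measurable outside an atom `A` of `m`, its conditional expectation given `m` is
`f` outside `A` and the average of `f` over `A` on `A`. -/
lemma condExp_ae_eq_indicator_add_of_atom {Ω : Type*} {m m₀ : MeasurableSpace Ω} {P : Measure Ω}
    [IsFiniteMeasure P] (hm : m ≤ m₀) {A : Set Ω} (hA : MeasurableSet[m] A)
    (hatom : ∀ s, MeasurableSet[m] s → A ⊆ s ∨ Disjoint A s) {f : Ω → ℝ} (hf : Integrable f P)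
    (hfm : StronglyMeasurable[m] (Aᶜ.indicator f)) {a : ℝ} (ha : P.real A * a = ∫ ω in A, f ω ∂P) :
    P[f | m] =ᵐ[P] A.indicator (fun _ => a) + Aᶜ.indicator f := by
  have hA₀ := hm _ hA
  have hint₁ : Integrable (A.indicator fun _ => a) P := (integrable_const a).indicator hA₀
  have hint₂ : Integrable (Aᶜ.indicator f) P := hf.indicator hA₀.compl
  refine (ae_eq_condExp_of_forall_setIntegral_eq hm hf
    (fun s _ _ => (hint₁.add hint₂).integrableOn) (fun s hs _ => ?_)
    ((stronglyMeasurable_const.indicator hA).add hfm).aestronglyMeasurable).symm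
  have hsplit : ∫ ω in s, f ω ∂P
      = ∫ ω in s, A.indicator f ω ∂P + ∫ ω in s, Aᶜ.indicator f ω ∂P := by
    rw [← integral_add (hf.indicator hA₀).integrableOn hint₂.integrableOn]
    simp [Set.indicator_self_add_compl_apply]
  simp only [Pi.add_apply]
  rw [integral_add hint₁.integrableOn hint₂.integrableOn, hsplit, setIntegral_indicator hA₀,
    setIntegral_indicator hA₀, setIntegral_const, smul_eq_mul]
  rcases hatom s hs with h | h
  · rw [Set.inter_eq_right.mpr h, ha]
  · rw [h.symm.inter_eq]
    simp

/-- Conditional expectation of a standard normal variable given its right-censored version. -/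
lemma condExp_min_gaussianReal {Ω : Type*} [MeasurableSpace Ω] {P : Measure Ω}
    [IsProbabilityMeasure P] {Z : Ω → ℝ} (hZm : Measurable Z)
    (hZ : Measure.map Z P = gaussianReal 0 1) (z : ℝ) :
    P[Z | MeasurableSpace.comap (fun ω => min (Z ω) z) inferInstance] =ᵐ[P]
      fun ω => (Set.Ici z).indicator (fun _ => normPDF z / (1 - normCDF z)) (Z ω)
        + (Set.Iio z).indicator id (Z ω) := by
  have hminm : Measurable fun ω => min (Z ω) z := hZm.min measurable_const
  have hA : Z ⁻¹' Set.Ici z = (fun ω => min (Z ω) z) ⁻¹' {z} := by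
    ext ω
    simp
  have hAc : (Z ⁻¹' Set.Ici z)ᶜ = Z ⁻¹' Set.Iio z := by
    rw [← Set.preimage_compl, Set.compl_Ici]
  have hint : Integrable Z P := by
    have := (memLp_id_gaussianReal (μ := 0) (v := 1) 1).integrable le_rfl
    rw [← hZ] at this
    exact this.comp_measurable hZm
  have hfm : StronglyMeasurable[MeasurableSpace.comap (fun ω => min (Z ω) z) inferInstance]
      ((Z ⁻¹' Set.Ici z)ᶜ.indicator Z) := by
    have : (Z ⁻¹' Set.Ici z)ᶜ.indicator Z
        = ((Set.Iio z).indicator id) ∘ fun ω => min (Z ω) z := by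
      ext ω
      rw [hAc]
      by_cases h : Z ω < z
      · simp [h, h.le]
      · simp [h]
    rw [this]
    exact ((measurable_id.indicator measurableSet_Iio).comp
      (comap_measurable _)).stronglyMeasurable
  have ha : P.real (Z ⁻¹' Set.Ici z) * (normPDF z / (1 - normCDF z))
      = ∫ ω in Z ⁻¹' Set.Ici z, Z ω ∂P := by
    have h := setIntegral_map (μ := P) (f := fun t : ℝ => t) (measurableSet_Ici (a := z))
      aestronglyMeasurable_id hZm.aemeasurable
    rw [← h, hZ, setIntegral_Ici_id_gaussianReal, ← map_measureReal_apply hZm measurableSet_Ici,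
      hZ, ← one_sub_normCDF_eq_gaussianReal_Ici, mul_div_cancel₀ _ (one_sub_normCDF_ne_zero z)]
  refine (condExp_ae_eq_indicator_add_of_atom hminm.comap_le ⟨{z}, measurableSet_singleton z,
    hA.symm⟩ ?_ hint hfm ha).trans (ae_of_all _ fun ω => ?_)
  · rintro s ⟨t, -, rfl⟩
    rw [hA]
    by_cases hz : z ∈ t
    · exact Or.inl (Set.preimage_mono (Set.singleton_subset_iff.mpr hz))
    · exact Or.inr ((Set.disjoint_singleton_left.mpr hz).preimage _)
  · rw [hAc]
    rfl

/-- The second moment of the conditional expectation of a standard normal variable given its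
right-censored version. -/
lemma integral_sq_censored_gaussianReal (z : ℝ) :
    ∫ t, ((Set.Ici z).indicator (fun _ => normPDF z / (1 - normCDF z)) t
      + (Set.Iio z).indicator id t) ^ 2 ∂(gaussianReal 0 1) = censorAdj z := by
  have hsq : Integrable (fun t : ℝ => t ^ 2) (gaussianReal 0 1) :=
    (memLp_id_gaussianReal (μ := 0) (v := 1) 2).integrable_sq
  have hsplit (t : ℝ) : ((Set.Ici z).indicator (fun _ => normPDF z / (1 - normCDF z)) t
      + (Set.Iio z).indicator id t) ^ 2
      = (Set.Ici z).indicator (fun _ => (normPDF z / (1 - normCDF z)) ^ 2) t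
        + (Set.Iio z).indicator (fun t => t ^ 2) t := by
    rcases lt_or_ge t z with h | h
    · simp [h]
    · simp [h]
  simp_rw [hsplit]
  rw [integral_add ((integrable_const _).indicator measurableSet_Ici)
    (hsq.indicator measurableSet_Iio), integral_indicator measurableSet_Ici,
    integral_indicator measurableSet_Iio, setIntegral_const, setIntegral_Iio_sq_gaussianReal,
    ← one_sub_normCDF_eq_gaussianReal_Ici, censorAdj]
  have := one_sub_normCDF_ne_zero z
  simp only [smul_eq_mul]
  field_simp
  ring

/-- For a bivariate normal pair `(X, Y)` and `W = min(X, c)` the right-censored observation,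
the expected conditional variance of `Y` given `σ(W)` is
`E[Y²] − E[(E[Y | σ(W)])²] = σY² · (1 − ρ²·h(z_c))`. -/
theorem censored_expected_conditional_variance
    {Ω : Type*} [MeasurableSpace Ω] (P : Measure Ω) [IsProbabilityMeasure P]
    (X ε Y W : Ω → ℝ) (hXm : Measurable X) (hεm : Measurable ε)
    (μX μY σX σY ρ c : ℝ) (hσX : 0 < σX) (hσY : 0 < σY) (hρ : ρ ∈ Set.Icc (-1 : ℝ) 1)
    (hX : Measure.map X P = gaussianReal μX (Real.toNNReal (σX ^ 2)))
    (hε : Measure.map ε P = gaussianReal 0 (Real.toNNReal ((1 - ρ ^ 2) * σY ^ 2)))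
    (hind : IndepFun X ε P)
    (hY : ∀ ω, Y ω = μY + ρ * (σY / σX) * (X ω - μX) + ε ω)
    (hW : ∀ ω, W ω = min (X ω) c) :
    (∫ ω, (Y ω) ^ 2 ∂P)
      - (∫ ω, ((P[Y | MeasurableSpace.comap W inferInstance]) ω) ^ 2 ∂P)
      = σY ^ 2 * (1 - ρ ^ 2 * censorAdj ((c - μX) / σX)) := by
  have hσX0 := hσX.ne'
  have hρ2 : 0 ≤ 1 - ρ ^ 2 := by nlinarith [hρ.1, hρ.2]
  set z := (c - μX) / σX with hz
  set Z : Ω → ℝ := fun ω => (X ω - μX) / σX with hZdef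
  have hZm : Measurable Z := (hXm.sub_const _).div_const _
  have hZ : Measure.map Z P = gaussianReal 0 1 := by
    have h := gaussianReal_div_const (gaussianReal_sub_const ⟨hXm.aemeasurable, hX⟩ μX) σX
    have hv : (σX ^ 2).toNNReal / NNReal.mk (σX ^ 2) (sq_nonneg _) = 1 := by
      ext
      simp [hσX0, sq_nonneg]
    rw [← hZdef, sub_self, zero_div, hv] at h
    exact h.map_eq
  have hYZ : Y = ((fun _ => μY) + (ρ * σY) • Z) + ε := by
    ext ω
    simp only [hY, Pi.add_apply, Pi.smul_apply, smul_eq_mul, hZdef]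
    field_simp
  have hcomap : MeasurableSpace.comap W inferInstance
      = MeasurableSpace.comap (fun ω => min (Z ω) z) inferInstance := by
    have hWZ : W = (fun t => σX * t + μX) ∘ fun ω => min (Z ω) z := by
      ext ω
      simp only [hW, Function.comp_apply, hZdef, hz, mul_min_of_nonneg _ _ hσX.le,
        mul_div_cancel₀ _ hσX0, min_add]
      simp
    have hZW : (fun ω => min (Z ω) z) = (fun t => (t - μX) / σX) ∘ W := by
      ext ω
      rw [hWZ]
      simp [hσX0]
    refine le_antisymm ?_ ?_
    · rw [hWZ, ← MeasurableSpace.comap_comp]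
      exact MeasurableSpace.comap_mono (by fun_prop : Measurable _).comap_le
    · rw [hZW, ← MeasurableSpace.comap_comp]
      exact MeasurableSpace.comap_mono (by fun_prop : Measurable _).comap_le
  have hindZ : IndepFun Z ε P :=
    hind.comp (φ := fun t => (t - μX) / σX) (ψ := id) (by fun_prop) measurable_id
  have hYlaw : Measure.map Y P = gaussianReal μY (Real.toNNReal (σY ^ 2)) := by
    have hlin := gaussianReal_const_add
      (gaussianReal_const_mul ⟨hZm.aemeasurable, hZ⟩ (ρ * σY)) μY
    have hind' : IndepFun ((fun _ => μY) + (ρ * σY) • Z) ε P :=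
      hindZ.comp (φ := fun t => μY + (ρ * σY) * t) (ψ := id) (by fun_prop) measurable_id
    rw [hYZ, gaussianReal_add_gaussianReal_of_indepFun hind' hlin.map_eq hε]
    congr 1
    · ring
    · ext
      rw [NNReal.coe_add, Real.coe_toNNReal _ (by positivity), Real.coe_toNNReal _ (sq_nonneg _)]
      simp
      ring
  have hYm : Measurable Y := by
    rw [hYZ]
    fun_prop
  have hYsq : ∫ ω, (Y ω) ^ 2 ∂P = σY ^ 2 + μY ^ 2 := by
    rw [← integral_map (f := fun y : ℝ => y ^ 2) hYm.aemeasurable (by fun_prop), hYlaw,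
      integral_sq_gaussianReal, Real.coe_toNNReal _ (sq_nonneg _)]
  have hZL2 : MemLp Z 2 P := by
    have := memLp_id_gaussianReal (μ := 0) (v := 1) 2
    rw [← hZ] at this
    exact this.comp_of_map hZm.aemeasurable
  have hZint : Integrable Z P := hZL2.integrable one_le_two
  have hZmean : ∫ ω, Z ω ∂P = 0 := by
    rw [← integral_map (f := fun y : ℝ => y) hZm.aemeasurable (by fun_prop), hZ,
      integral_id_gaussianReal]
  have hεint : Integrable ε P := by
    have := (memLp_id_gaussianReal (μ := 0) (v := ((1 - ρ ^ 2) * σY ^ 2).toNNReal) 1).integrable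
      le_rfl
    rw [← hε] at this
    exact this.comp_measurable hεm
  have hεmean : ∫ ω, ε ω ∂P = 0 := by
    rw [← integral_map (f := fun y : ℝ => y) hεm.aemeasurable (by fun_prop), hε,
      integral_id_gaussianReal]
  have hminm : Measurable fun ω => min (Z ω) z := hZm.min measurable_const
  have hindmin : IndepFun ε (fun ω => min (Z ω) z) P :=
    hindZ.symm.comp (φ := id) (ψ := fun t => min t z) measurable_id (by fun_prop)
  have hcensored : ∫ ω, ((Set.Ici z).indicator (fun _ => normPDF z / (1 - normCDF z)) (Z ω)
      + (Set.Iio z).indicator id (Z ω)) ^ 2 ∂P = censorAdj z := by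
    rw [← integral_sq_censored_gaussianReal z, ← hZ, integral_map hZm.aemeasurable]
    exact (((measurable_const.indicator measurableSet_Ici).add
      (measurable_id.indicator measurableSet_Iio)).pow_const 2).aestronglyMeasurable
  have hZcond := condExp_min_gaussianReal hZm hZ z
  rw [hYsq, hcomap]
  set m := MeasurableSpace.comap (fun ω => min (Z ω) z) inferInstance
  have hεcond : P[ε | m] =ᵐ[P] fun _ => 0 := by
    have := condExp_indep_eq hεm.comap_le hminm.comap_le
      (comap_measurable ε).stronglyMeasurable hindmin
    rwa [hεmean] at this
  have hYcond : P[Y | m] =ᵐ[P] fun ω => μY + ρ * σY * P[Z | m] ω := by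
    rw [hYZ]
    have hconst : Integrable (fun _ : Ω => μY) P := integrable_const _
    filter_upwards [condExp_add (hconst.add (hZint.smul (ρ * σY))) hεint m,
      condExp_add hconst (hZint.smul (ρ * σY)) m, condExp_smul (μ := P) (ρ * σY) Z m, hεcond]
      with ω h₁ h₂ h₃ h₄
    rw [h₁, Pi.add_apply, h₂, Pi.add_apply, h₃, h₄, condExp_const hminm.comap_le]
    simp
  have hZcondsq : ∫ ω, (P[Z | m] ω) ^ 2 ∂P = censorAdj z := by
    rw [← hcensored]
    refine integral_congr_ae ?_
    filter_upwards [hZcond] with ω h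
    rw [h]
  have hcondsq : ∫ ω, (P[Y | m] ω) ^ 2 ∂P = μY ^ 2 + (ρ * σY) ^ 2 * censorAdj z := by
    have hint₀ : Integrable (fun ω => 2 * μY * (ρ * σY) * P[Z | m] ω) P :=
      integrable_condExp.const_mul _
    have hint₁ : Integrable (fun ω => μY ^ 2 + 2 * μY * (ρ * σY) * P[Z | m] ω) P :=
      (integrable_const _).add hint₀
    have hint₂ : Integrable (fun ω => (ρ * σY) ^ 2 * (P[Z | m] ω) ^ 2) P :=
      (hZL2.condExp one_le_two).integrable_sq.const_mul _
    calc ∫ ω, (P[Y | m] ω) ^ 2 ∂P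
        = ∫ ω, (μY ^ 2 + 2 * μY * (ρ * σY) * P[Z | m] ω)
            + (ρ * σY) ^ 2 * (P[Z | m] ω) ^ 2 ∂P := by
          refine integral_congr_ae ?_
          filter_upwards [hYcond] with ω h
          rw [h]
          ring
      _ = μY ^ 2 + (ρ * σY) ^ 2 * censorAdj z := by
          rw [integral_add hint₁ hint₂,
            integral_add (integrable_const _) hint₀, integral_const_mul, integral_const_mul,
            integral_condExp hminm.comap_le, hZmean, hZcondsq]
          simp
  rw [hcondsq]
  ring
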